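/- Let F be a positive integer. (Forward direction) If (d_1, d_2, ..., d_p) is a Sat(F)-sequence and t_1, t_2, ..., t_p are positive integers such that t_1·d_1 + ... + t_p·d_p < F and gcd(d_i/d_{i+1}, t_{i+1}) = 1 for all i ∈ {1,...,p−1}, then the set {d_1, t_1·d_1 + t_2·d_2, ..., t_1·d_1 + t_2·d_2 + ... + t_p·d_p} is the minimal Sat(F)-system of generators of an element of Sat(F) of Sat(F)-rank equal to p. (Converse) Every minimal Sat(F)-system of generators of an element of Sat(F) of Sat(F)-rank p has this form: it equals {n_1 < n_2 < ... < n_p} where, setting d_i = gcd{n_1,...,n_i}, the tuple (d_1,...,d_p) is a Sat(F)-sequence and there exist positive integers t_1 = 1, t_2, ..., t_p with n_i = t_1·d_1 + ... + t_i·d_i for all i and gcd(d_i/d_{i+1}, t_{i+1}) = 1 for all i ∈ {1,...,p−1}. -/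

import Mathlib

/-- A numerical semigroup: subset of ℕ containing 0, closed under addition,
with finite complement. -/
def IsNumericalSemigroup (S : Set ℕ) : Prop :=
  0 ∈ S ∧ (∀ a ∈ S, ∀ b ∈ S, a + b ∈ S) ∧ Sᶜ.Finite

/-- `dOf S s = gcd {x ∈ S : x ≤ s}`. -/
noncomputable def dOf (S : Set ℕ) (s : ℕ) : ℕ :=
  letI := Classical.decPred (· ∈ S)
  ((Finset.range (s + 1)).filter (· ∈ S)).gcd id

/-- A saturated numerical semigroup. -/
def IsSaturatedNS (S : Set ℕ) : Prop :=
  IsNumericalSemigroup S ∧ ∀ s ∈ S, s ≠ 0 → s + dOf S s ∈ S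

/-- `Sat F`: saturated numerical semigroups with Frobenius number `F`. -/
def SatF (F : ℕ) : Set (Set ℕ) :=
  {S | IsSaturatedNS S ∧ F ∉ S ∧ ∀ x, x ∉ S → x ≤ F}

/-- Multiplicity: least nonzero element. -/
noncomputable def multOf (S : Set ℕ) : ℕ := sInf {x | x ∈ S ∧ x ≠ 0}

/-- Pseudo-Frobenius numbers. -/
def PFset (S : Set ℕ) : Set ℕ := {z | z ∉ S ∧ ∀ s ∈ S, s ≠ 0 → z + s ∈ S}

/-- Special gaps. -/
def SGset (S : Set ℕ) : Set ℕ := {x | x ∈ PFset S ∧ 2 * x ∈ S}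

/-- `TSet a b = ⟨a⟩ ∪ {x : x ≥ b}`. -/
def TSet (a b : ℕ) : Set ℕ := {x | a ∣ x} ∪ {x | b ≤ x}

/-- A `Sat(F)`-set. -/
def SatFSet (F : ℕ) (X : Set ℕ) : Prop :=
  X ∩ ({0} ∪ {x | F + 1 ≤ x}) = ∅ ∧ ∃ S ∈ SatF F, X ⊆ S

/-- `Sat(F)[X]`: intersection of all elements of `Sat F` containing `X`. -/
def SatClosure (F : ℕ) (X : Set ℕ) : Set ℕ := ⋂₀ {S | S ∈ SatF F ∧ X ⊆ S}

/-- `X` is a minimal `Sat(F)`-system of generators of `S`. -/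
def IsMinSatGen (F : ℕ) (X S : Set ℕ) : Prop :=
  SatFSet F X ∧ SatClosure F X = S ∧ ∀ Y : Set ℕ, Y ⊂ X → SatClosure F Y ≠ S

/-- The `Sat(F)`-rank of `S`: minimal cardinality of a `Sat(F)`-set `X`
with `Sat(F)[X] = S`. -/
noncomputable def SatRank (F : ℕ) (S : Set ℕ) : ℕ :=
  sInf {k | ∃ X : Set ℕ, SatFSet F X ∧ SatClosure F X = S ∧ X.ncard = k}

/-- A `Sat(F)`-sequence of length `p` (indexed by `1,…,p`):
`d 1 > d 2 > ⋯ > d p` positive, `d (i+1) ∣ d i`, and `d p ∤ F`. -/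
def IsSatSeq (F p : ℕ) (d : ℕ → ℕ) : Prop :=
  (∀ i, 1 ≤ i → i ≤ p → 0 < d i) ∧
  (∀ i, 1 ≤ i → i < p → d (i + 1) < d i) ∧
  (∀ i, 1 ≤ i → i < p → d (i + 1) ∣ d i) ∧
  ¬ d p ∣ F

lemma dvd_dOf_iff {S : Set ℕ} {k s : ℕ} :
    k ∣ dOf S s ↔ ∀ x ∈ S, x ≤ s → k ∣ x := by
  classical
  simp only [dOf, Finset.dvd_gcd_iff, Finset.mem_filter, Finset.mem_range, id]
  exact ⟨fun h x hx hs => h x ⟨by omega, hx⟩, fun h x hx => h x hx.2 (by omega)⟩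

lemma dOf_dvd_of_mem {S : Set ℕ} {x s : ℕ} (hx : x ∈ S) (hxs : x ≤ s) : dOf S s ∣ x :=
  dvd_dOf_iff.1 dvd_rfl x hx hxs

lemma dOf_dvd_dOf {S T : Set ℕ} {a b : ℕ} (hST : S ⊆ T) (hab : a ≤ b) :
    dOf T b ∣ dOf S a :=
  dvd_dOf_iff.2 fun _ hx hxa => dOf_dvd_of_mem (hST hx) (hxa.trans hab)

/-- The explicit form of `SatClosure F X` for a `Sat(F)`-set `X`. -/
def satHull (F : ℕ) (X : Set ℕ) : Set ℕ := {x | F < x ∨ dOf X x ∣ x}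

lemma subset_satHull (F : ℕ) (X : Set ℕ) : X ⊆ satHull F X :=
  fun _ hx => Or.inr (dOf_dvd_of_mem hx le_rfl)

lemma dOf_satHull {F s : ℕ} (X : Set ℕ) (hs : s ≤ F) : dOf (satHull F X) s = dOf X s := by
  refine Nat.dvd_antisymm (dOf_dvd_dOf (subset_satHull F X) le_rfl) (dvd_dOf_iff.2 ?_)
  rintro x (hx | hx) hxs
  · omega
  · exact (dOf_dvd_dOf subset_rfl hxs).trans hx

lemma satHull_mem_SatF {F : ℕ} {X : Set ℕ} (h : ¬ dOf X F ∣ F) : satHull F X ∈ SatF F := by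
  refine ⟨⟨⟨Or.inr (dvd_zero _), ?_, ?_⟩, ?_⟩, ?_, ?_⟩
  · intro a ha b hb
    by_cases hab : F < a + b
    · exact Or.inl hab
    · have ha' := ha.resolve_left (by omega)
      have hb' := hb.resolve_left (by omega)
      exact Or.inr (dvd_add ((dOf_dvd_dOf subset_rfl (by omega)).trans ha')
        ((dOf_dvd_dOf subset_rfl (by omega)).trans hb'))
  · refine (Set.finite_Iic F).subset fun x hx => ?_
    by_contra hxF
    exact hx (Or.inl (by simpa using hxF))
  · intro s hs _
    by_cases hsF : F < s
    · exact Or.inl (by omega)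
    · rw [dOf_satHull X (by omega)]
      have hdvd : dOf X (s + dOf X s) ∣ dOf X s := dOf_dvd_dOf subset_rfl (by omega)
      exact Or.inr (dvd_add (hdvd.trans (hs.resolve_left hsF)) hdvd)
  · rintro (hF | hF)
    · omega
    · exact h hF
  · intro x hx
    by_contra hxF
    exact hx (Or.inl (by omega))

lemma IsSaturatedNS.add_mem_of_dOf_dvd {T : Set ℕ} (hT : IsSaturatedNS T) :
    ∀ m s : ℕ, s ∈ T → s ≠ 0 → dOf T s ∣ m → s + m ∈ T := by
  intro m
  induction m using Nat.strong_induction_on with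
  | _ m ih =>
    intro s hs hs0 hm
    rcases Nat.eq_zero_or_pos m with rfl | hm0
    · simpa using hs
    have hpos : 0 < dOf T s := Nat.pos_of_dvd_of_pos hm hm0
    have hle : dOf T s ≤ m := Nat.le_of_dvd hm0 hm
    have hmem := ih (m - dOf T s) (by omega) (s + dOf T s) (hT.2 s hs hs0) (by omega)
      ((dOf_dvd_dOf subset_rfl (by omega)).trans (Nat.dvd_sub hm dvd_rfl))
    rwa [show s + dOf T s + (m - dOf T s) = s + m by omega] at hmem

lemma satHull_subset {F : ℕ} {X T : Set ℕ} (hT : T ∈ SatF F) (hX : ∀ x ∈ X, x ≠ 0)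
    (hXT : X ⊆ T) : satHull F X ⊆ T := by
  classical
  intro x hx
  by_contra hxT
  have hxF := hT.2.2 x hxT
  have hx' := hx.resolve_left (by omega)
  have hx0 : x ≠ 0 := fun h => hxT (h ▸ hT.1.1.1)
  have hne : ((Finset.range (x + 1)).filter (· ∈ X)).Nonempty := by
    by_contra hempty
    rw [Finset.not_nonempty_iff_eq_empty, Finset.filter_eq_empty_iff] at hempty
    have hzero : 0 ∣ dOf X x :=
      dvd_dOf_iff.2 fun y hy hyx => absurd hy (hempty (Finset.mem_range.2 (by omega)))
    exact hx0 (Nat.eq_zero_of_zero_dvd (hzero.trans hx'))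
  obtain ⟨y, hy, hmax⟩ := Finset.exists_max_image _ id hne
  simp only [Finset.mem_filter, Finset.mem_range, id] at hy hmax
  have hd : dOf T y ∣ dOf X x := dvd_dOf_iff.2 fun z hz hzx =>
    dOf_dvd_of_mem (hXT hz) (hmax z ⟨by omega, hz⟩)
  have hmem := hT.1.add_mem_of_dOf_dvd (x - y) y (hXT hy.2) (hX y hy.2)
    (Nat.dvd_sub (hd.trans hx') (dOf_dvd_of_mem (hXT hy.2) le_rfl))
  rw [Nat.add_sub_cancel' (by omega)] at hmem
  exact hxT hmem

lemma SatFSet.pos_and_le {F x : ℕ} {X : Set ℕ} (hX : SatFSet F X) (hx : x ∈ X) :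
    0 < x ∧ x ≤ F := by
  have h : x ∉ X ∩ ({0} ∪ {x | F + 1 ≤ x}) := by rw [hX.1]; exact Set.notMem_empty x
  simp only [Set.mem_inter_iff, hx, true_and, Set.mem_union, Set.mem_singleton_iff,
    Set.mem_ofPred_eq] at h
  omega

lemma SatFSet.not_dOf_dvd {F : ℕ} {X : Set ℕ} (hX : SatFSet F X) : ¬ dOf X F ∣ F := by
  obtain ⟨T, hT, hXT⟩ := hX.2
  exact fun h => hT.2.1 (satHull_subset hT (fun x hx => (hX.pos_and_le hx).1.ne') hXT (Or.inr h))

lemma satFSet_of_not_dOf_dvd {F : ℕ} {X : Set ℕ} (hX : ∀ x ∈ X, 0 < x ∧ x ≤ F)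
    (h : ¬ dOf X F ∣ F) : SatFSet F X := by
  refine ⟨?_, satHull F X, satHull_mem_SatF h, subset_satHull F X⟩
  ext x
  simp only [Set.mem_inter_iff, Set.mem_union, Set.mem_singleton_iff, Set.mem_ofPred_eq,
    Set.mem_empty_iff_false, iff_false, not_and]
  intro hx
  have := hX x hx
  omega

lemma SatFSet.mono {F : ℕ} {X Y : Set ℕ} (hX : SatFSet F X) (hYX : Y ⊆ X) : SatFSet F Y :=
  satFSet_of_not_dOf_dvd (fun _ hx => hX.pos_and_le (hYX hx))
    fun h => hX.not_dOf_dvd ((dOf_dvd_dOf hYX le_rfl).trans h)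

lemma SatFSet.finite {F : ℕ} {X : Set ℕ} (hX : SatFSet F X) : X.Finite :=
  (Set.finite_Iic F).subset fun _ hx => (hX.pos_and_le hx).2

lemma SatFSet.satClosure_eq {F : ℕ} {X : Set ℕ} (hX : SatFSet F X) :
    SatClosure F X = satHull F X :=
  Set.Subset.antisymm
    (Set.sInter_subset_of_mem ⟨satHull_mem_SatF hX.not_dOf_dvd, subset_satHull F X⟩)
    (Set.subset_sInter fun _ hT =>
      satHull_subset hT.1 (fun _ hx => (hX.pos_and_le hx).1.ne') hT.2)

/-- A `Sat(F)`-set all of whose elements change the running gcd lies in every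
`Sat(F)`-system of generators of the same semigroup. -/
lemma SatFSet.subset_of_satClosure_eq {F : ℕ} {X Y : Set ℕ} (hX : SatFSet F X)
    (hY : SatFSet F Y) (hXY : SatClosure F Y = SatClosure F X)
    (hjump : ∀ x ∈ X, ¬ dOf X (x - 1) ∣ x) : X ⊆ Y := by
  intro x hx
  by_contra hxY
  rw [hX.satClosure_eq, hY.satClosure_eq] at hXY
  have hxF := hX.pos_and_le hx
  have hd : ∀ z ≤ F, dOf Y z = dOf X z := fun z hz => by
    rw [← dOf_satHull X hz, ← dOf_satHull Y hz, hXY]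
  refine hjump x hx ?_
  rw [← hd _ (by omega)]
  have hstep : dOf Y (x - 1) ∣ dOf Y x := dvd_dOf_iff.2 fun y hy hyx => by
    have hne : y ≠ x := fun h => hxY (h ▸ hy)
    exact dOf_dvd_of_mem hy (by omega)
  exact hstep.trans (hd x hxF.2 ▸ dOf_dvd_of_mem hx le_rfl)

lemma isMinSatGen_iff {F : ℕ} {X S : Set ℕ} :
    IsMinSatGen F X S ↔
      SatFSet F X ∧ SatClosure F X = S ∧ ∀ x ∈ X, ¬ dOf X (x - 1) ∣ x := by
  constructor
  · rintro ⟨hX, hS, hmin⟩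
    refine ⟨hX, hS, fun x hx hdvd => ?_⟩
    have hsub : X \ {x} ⊆ X := Set.sdiff_subset
    refine hmin (X \ {x}) ⟨hsub, fun h => (h hx).2 rfl⟩ ?_
    rw [← hS, (hX.mono hsub).satClosure_eq, hX.satClosure_eq]
    have hd : ∀ z, dOf (X \ {x}) z = dOf X z := fun z => by
      refine Nat.dvd_antisymm (dvd_dOf_iff.2 fun y hy hyz => ?_) (dOf_dvd_dOf hsub le_rfl)
      by_cases hyx : y = x
      · subst hyx
        refine Dvd.dvd.trans (dvd_dOf_iff.2 fun w hw hwy => ?_) hdvd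
        have := hX.pos_and_le hx
        exact dOf_dvd_of_mem ⟨hw, by simp only [Set.mem_singleton_iff]; omega⟩ (by omega)
      · exact dOf_dvd_of_mem ⟨hy, hyx⟩ hyz
    simp only [satHull, hd]
  · rintro ⟨hX, hS, hjump⟩
    refine ⟨hX, hS, fun Y hYX hY => hYX.2 ?_⟩
    exact hX.subset_of_satClosure_eq (hX.mono hYX.1) (hY.trans hS.symm) hjump

lemma IsMinSatGen.satRank_eq {F : ℕ} {X S : Set ℕ} (h : IsMinSatGen F X S) :
    SatRank F S = X.ncard := by
  obtain ⟨hX, hS, hjump⟩ := isMinSatGen_iff.1 h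
  refine le_antisymm (Nat.sInf_le ⟨X, hX, hS, rfl⟩) (le_csInf ⟨_, X, hX, hS, rfl⟩ ?_)
  rintro k ⟨Y, hY, hYS, rfl⟩
  exact Set.ncard_le_ncard (hX.subset_of_satClosure_eq hY (hYS.trans hS.symm) hjump) hY.finite

lemma lt_of_lt_succ_on {n : ℕ → ℕ} {p : ℕ} (hn : ∀ i, 1 ≤ i → i < p → n i < n (i + 1))
    {i j : ℕ} (hi : 1 ≤ i) (hij : i < j) (hj : j ≤ p) : n i < n j := by
  induction j, hij using Nat.le_induction with
  | base => exact hn i hi (by omega)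
  | succ j hij ih => exact (ih (by omega)).trans (hn j (by omega) (by omega))

lemma dOf_eq_gcd_of_mem_Ico {n : ℕ → ℕ} {p i z : ℕ}
    (hn : ∀ i, 1 ≤ i → i < p → n i < n (i + 1)) (hi : 1 ≤ i) (hip : i ≤ p)
    (hz : n i ≤ z) (hz' : i < p → z < n (i + 1)) :
    dOf {x | ∃ i, 1 ≤ i ∧ i ≤ p ∧ x = n i} z = (Finset.Icc 1 i).gcd n := by
  refine Nat.dvd_antisymm (Finset.dvd_gcd fun j hj => ?_) (dvd_dOf_iff.2 ?_)
  · rw [Finset.mem_Icc] at hj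
    refine dOf_dvd_of_mem ⟨j, hj.1, hj.2.trans hip, rfl⟩ (le_trans ?_ hz)
    rcases hj.2.eq_or_lt with rfl | hlt
    · exact le_rfl
    · exact (lt_of_lt_succ_on hn hj.1 hlt hip).le
  · rintro x ⟨j, hj, hjp, rfl⟩ hjz
    refine Finset.gcd_dvd (Finset.mem_Icc.2 ⟨hj, ?_⟩)
    by_contra hij
    have := hz' (by omega)
    rcases (show i + 1 ≤ j by omega).eq_or_lt with rfl | hlt
    · omega
    · have := lt_of_lt_succ_on hn (by omega) hlt hjp
      omega

lemma gcd_Icc_succ (n : ℕ → ℕ) (i : ℕ) :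
    (Finset.Icc 1 (i + 1)).gcd n = Nat.gcd ((Finset.Icc 1 i).gcd n) (n (i + 1)) := by
  rw [← Finset.insert_Icc_right_eq_Icc_add_one (by omega), Finset.gcd_insert, gcd_comm]
  rfl

lemma ncard_setOf_eq_of_lt_succ {n : ℕ → ℕ} {p : ℕ}
    (hn : ∀ i, 1 ≤ i → i < p → n i < n (i + 1)) :
    {x | ∃ i, 1 ≤ i ∧ i ≤ p ∧ x = n i}.ncard = p := by
  have himage : {x | ∃ i, 1 ≤ i ∧ i ≤ p ∧ x = n i} = n '' (Finset.Icc 1 p : Set ℕ) := by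
    ext x
    simp [eq_comm, and_assoc]
  have hinj : Set.InjOn n (Finset.Icc 1 p : Set ℕ) := by
    intro a ha b hb hab
    simp only [Finset.coe_Icc, Set.mem_Icc] at ha hb
    rcases lt_trichotomy a b with h | h | h
    · exact absurd hab (lt_of_lt_succ_on hn ha.1 h hb.2).ne
    · exact h
    · exact absurd hab (lt_of_lt_succ_on hn hb.1 h ha.2).ne'
  rw [himage, hinj.ncard_image, Set.ncard_coe_finset]
  simp

lemma exists_enumeration {X : Set ℕ} (hX : X.Finite) :
    ∃ n : ℕ → ℕ, X = {x | ∃ i, 1 ≤ i ∧ i ≤ X.ncard ∧ x = n i} ∧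
      ∀ i, 1 ≤ i → i < X.ncard → n i < n (i + 1) := by
  have hcard : hX.toFinset.card = X.ncard := (Set.ncard_eq_toFinset_card X hX).symm
  have hX' : (Set.ofPred (· ∈ X)).Finite := hX
  refine ⟨fun i => Nat.nth (· ∈ X) (i - 1), ?_, fun i hi hip => ?_⟩
  · ext x
    constructor
    · intro hx
      obtain ⟨k, hk, rfl⟩ := Nat.exists_lt_card_finite_nth_eq hX' hx
      exact ⟨k + 1, by omega, by rw [← hcard]; exact hk, by simp⟩
    · rintro ⟨i, hi, hip, rfl⟩
      refine Nat.nth_mem_of_lt_card hX' ?_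
      change _ < hX.toFinset.card
      omega
  · refine Nat.nth_lt_nth_of_lt_card hX' (by omega) ?_
    change _ < hX.toFinset.card
    omega

lemma gcd_add_mul_of_coprime_div {a b c t : ℕ} (hb : 0 < b) (hba : b ∣ a) (hac : a ∣ c)
    (ht : Nat.gcd (a / b) t = 1) : Nat.gcd a (c + t * b) = b := by
  obtain ⟨q, rfl⟩ := hba
  obtain ⟨r, rfl⟩ := hac
  rw [Nat.mul_div_cancel_left q hb] at ht
  rw [Nat.gcd_mul_left_add_right, mul_comm t b, Nat.gcd_mul_left, ht, mul_one]

/-- description of the minimal `Sat(F)`-systems of generators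
of the elements of `Sat(F)` of `Sat(F)`-rank `p`. -/
theorem minimal_generators_of_rank (F p : ℕ) (hF : 0 < F) (hp : 0 < p) :
    (∀ d t : ℕ → ℕ, IsSatSeq F p d →
      (∀ i, 1 ≤ i → i ≤ p → 0 < t i) →
      (∑ i ∈ Finset.Icc 1 p, t i * d i) < F →
      (∀ i, 1 ≤ i → i < p → Nat.gcd (d i / d (i + 1)) (t (i + 1)) = 1) →
      ∃ S ∈ SatF F,
        IsMinSatGen F
          ({d 1} ∪
            {x | ∃ j, 2 ≤ j ∧ j ≤ p ∧ x = ∑ i ∈ Finset.Icc 1 j, t i * d i})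
          S ∧
        SatRank F S = p) ∧
    (∀ S ∈ SatF F, SatRank F S = p → ∀ X : Set ℕ, IsMinSatGen F X S →
      ∃ n d t : ℕ → ℕ,
        X = {x | ∃ i, 1 ≤ i ∧ i ≤ p ∧ x = n i} ∧
        (∀ i, 1 ≤ i → i < p → n i < n (i + 1)) ∧
        (∀ i, 1 ≤ i → i ≤ p → d i = (Finset.Icc 1 i).gcd n) ∧
        IsSatSeq F p d ∧
        t 1 = 1 ∧
        (∀ i, 1 ≤ i → i ≤ p → 0 < t i) ∧
        (∀ i, 1 ≤ i → i ≤ p → n i = ∑ j ∈ Finset.Icc 1 i, t j * d j) ∧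
        (∀ i, 1 ≤ i → i < p →
          Nat.gcd (d i / d (i + 1)) (t (i + 1)) = 1)) := by
  constructor
  · rintro d t ⟨hpos, hlt, hdvd, hF'⟩ ht hsum hcop
    let s : ℕ → ℕ := fun j => ∑ i ∈ Finset.Icc 1 j, t i * d i
    have hs_one : s 1 = t 1 * d 1 := by simp [s]
    have hs_succ : ∀ i, s (i + 1) = s i + t (i + 1) * d (i + 1) := fun i =>
      Finset.sum_Icc_succ_top (by omega) _
    have hd_s : ∀ i, 1 ≤ i → i ≤ p → d i ∣ s i := by
      intro i hi
      induction i, hi using Nat.le_induction with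
      | base => exact fun _ => hs_one ▸ dvd_mul_left _ _
      | succ i hi ih =>
        intro hip
        rw [hs_succ]
        exact dvd_add ((hdvd i hi (by omega)).trans (ih (by omega))) (dvd_mul_left _ _)
    have hs_mono : Monotone s := monotone_nat_of_le_succ fun i => by rw [hs_succ]; omega
    let n : ℕ → ℕ := fun i => if i = 1 then d 1 else s i
    have hn_one : n 1 = d 1 := if_pos rfl
    have hn_succ : ∀ i, 1 ≤ i → n (i + 1) = s i + t (i + 1) * d (i + 1) := fun i hi => by
      rw [← hs_succ]; exact if_neg (by omega)
    have hn_le : ∀ i, n i ≤ s i := by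
      intro i
      by_cases hi : i = 1
      · subst hi
        rw [hn_one, hs_one]
        exact Nat.le_mul_of_pos_left _ (ht 1 le_rfl hp)
      · exact (if_neg hi).le
    have hn : ∀ i, 1 ≤ i → i < p → n i < n (i + 1) := fun i hi hip => by
      rw [hn_succ i hi]
      have := hn_le i
      have := Nat.mul_pos (ht (i + 1) (by omega) hip) (hpos (i + 1) (by omega) hip)
      omega
    have hgcd : ∀ i, 1 ≤ i → i ≤ p → (Finset.Icc 1 i).gcd n = d i := by
      intro i hi
      induction i, hi using Nat.le_induction with
      | base => intro _; simp [hn_one]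
      | succ i hi ih =>
        intro hip
        rw [gcd_Icc_succ, ih (by omega), hn_succ i hi]
        exact gcd_add_mul_of_coprime_div (hpos _ (by omega) hip) (hdvd i hi hip)
          (hd_s i hi (by omega)) (hcop i hi hip)
    have hX : {d 1} ∪ {x | ∃ j, 2 ≤ j ∧ j ≤ p ∧ x = ∑ i ∈ Finset.Icc 1 j, t i * d i} =
        {x | ∃ i, 1 ≤ i ∧ i ≤ p ∧ x = n i} := by
      ext x
      constructor
      · rintro (rfl | ⟨j, hj, hjp, rfl⟩)
        · exact ⟨1, le_rfl, hp, hn_one.symm⟩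
        · exact ⟨j, by omega, hjp, (if_neg (by omega)).symm⟩
      · rintro ⟨i, hi, hip, rfl⟩
        by_cases h : i = 1
        · exact Or.inl (h ▸ hn_one)
        · exact Or.inr ⟨i, by omega, hip, if_neg h⟩
    have hn_lt : ∀ i, i ≤ p → n i < F := fun i hip =>
      ((hn_le i).trans (hs_mono hip)).trans_lt hsum
    have hset : SatFSet F {x | ∃ i, 1 ≤ i ∧ i ≤ p ∧ x = n i} := by
      refine satFSet_of_not_dOf_dvd ?_ ?_
      · rintro x ⟨i, hi, hip, rfl⟩
        refine ⟨?_, (hn_lt i hip).le⟩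
        rcases hi.eq_or_lt with rfl | hi
        · exact hn_one ▸ hpos 1 le_rfl hp
        · exact (Nat.zero_le _).trans_lt (lt_of_lt_succ_on hn le_rfl hi hip)
      · rwa [dOf_eq_gcd_of_mem_Ico hn hp le_rfl (hn_lt p le_rfl).le (by omega),
          hgcd p hp le_rfl]
    rw [hX]
    have hmin : IsMinSatGen F {x | ∃ i, 1 ≤ i ∧ i ≤ p ∧ x = n i}
        (satHull F {x | ∃ i, 1 ≤ i ∧ i ≤ p ∧ x = n i}) := by
      refine isMinSatGen_iff.2 ⟨hset, hset.satClosure_eq, ?_⟩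
      rintro x ⟨i, hi, hip, rfl⟩ hdiv
      rcases hi.eq_or_lt with rfl | hi
      · have hzero : 0 ∣ n 1 := by
          refine Dvd.dvd.trans (dvd_dOf_iff.2 ?_) hdiv
          rintro x ⟨j, hj, hjp, rfl⟩ hlt
          have h1 := hpos 1 le_rfl hp
          rcases hj.eq_or_lt with rfl | hj
          · omega
          · have := lt_of_lt_succ_on hn le_rfl hj hjp
            omega
        have := hpos 1 le_rfl hp
        have := Nat.eq_zero_of_zero_dvd hzero
        omega
      · obtain ⟨k, rfl⟩ : ∃ k, i = k + 1 := ⟨i - 1, by omega⟩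
        have hk := hn k (by omega) hip
        rw [dOf_eq_gcd_of_mem_Ico hn (show 1 ≤ k by omega) (by omega) (by omega)
          (by omega)] at hdiv
        have hkk := hgcd (k + 1) (by omega) hip
        rw [gcd_Icc_succ, Nat.gcd_eq_left hdiv, hgcd k (by omega) (by omega)] at hkk
        exact (hlt k (by omega) hip).ne' hkk
    exact ⟨_, satHull_mem_SatF hset.not_dOf_dvd, hmin,
      hmin.satRank_eq.trans (ncard_setOf_eq_of_lt_succ hn)⟩
  · rintro S - hrank X hmin
    obtain ⟨hset, -, hjump⟩ := isMinSatGen_iff.1 hmin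
    obtain ⟨n, hX, hn⟩ := exists_enumeration hset.finite
    rw [← hmin.satRank_eq, hrank] at hX hn
    have hn_mem : ∀ i, 1 ≤ i → i ≤ p → n i ∈ X := fun i hi hip => by
      rw [hX]; exact ⟨i, hi, hip, rfl⟩
    have hn_pos : ∀ i, 1 ≤ i → i ≤ p → 0 < n i ∧ n i ≤ F := fun i hi hip =>
      hset.pos_and_le (hn_mem i hi hip)
    let d : ℕ → ℕ := fun i => (Finset.Icc 1 i).gcd n
    have hdOf : ∀ i z, 1 ≤ i → i ≤ p → n i ≤ z → (i < p → z < n (i + 1)) →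
        dOf X z = d i := fun i z hi hip hz hz' => by
      rw [hX]; exact dOf_eq_gcd_of_mem_Ico hn hi hip hz hz'
    have hd_succ : ∀ i, d (i + 1) = Nat.gcd (d i) (n (i + 1)) := gcd_Icc_succ n
    have hd_dvd : ∀ i, d (i + 1) ∣ d i := fun i => hd_succ i ▸ Nat.gcd_dvd_left _ _
    have hd_n : ∀ i, 1 ≤ i → d i ∣ n i := fun i hi =>
      Finset.gcd_dvd (Finset.mem_Icc.2 ⟨hi, le_rfl⟩)
    have hd_pos : ∀ i, 1 ≤ i → i ≤ p → 0 < d i := fun i hi hip =>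
      Nat.pos_of_dvd_of_pos (hd_n i hi) (hn_pos i hi hip).1
    have hd_one : d 1 = n 1 := by simp [d]
    have hd_ndvd : ∀ i, 1 ≤ i → i < p → ¬ d i ∣ n (i + 1) := fun i hi hip => by
      have := hn i hi hip
      rw [← hdOf i (n (i + 1) - 1) hi hip.le (by omega) (by omega)]
      exact hjump _ (hn_mem (i + 1) (by omega) hip)
    let t : ℕ → ℕ := fun i => if i = 1 then 1 else (n i - n (i - 1)) / d i
    have ht_one : t 1 = 1 := if_pos rfl
    have ht_mul : ∀ i, 1 ≤ i → i < p →
        n (i + 1) = n i + t (i + 1) * d (i + 1) := fun i hi hip => by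
      have ht : t (i + 1) = (n (i + 1) - n i) / d (i + 1) := if_neg (by omega)
      rw [ht, Nat.div_mul_cancel
        (Nat.dvd_sub (hd_n (i + 1) (by omega)) ((hd_dvd i).trans (hd_n i hi)))]
      have := hn i hi hip
      omega
    refine ⟨n, d, t, hX, hn, fun _ _ _ => rfl, ⟨hd_pos, fun i hi hip => ?_,
      fun i _ _ => hd_dvd i, ?_⟩, ht_one, fun i hi hip => ?_, fun i hi => ?_,
      fun i hi hip => ?_⟩
    · refine lt_of_le_of_ne (Nat.le_of_dvd (hd_pos i hi hip.le) (hd_dvd i)) fun h => ?_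
      exact hd_ndvd i hi hip (h ▸ hd_n (i + 1) (by omega))
    · rw [← hdOf p F hp le_rfl (hn_pos p hp le_rfl).2 (by omega)]
      exact hset.not_dOf_dvd
    · rcases hi.eq_or_lt with rfl | hi
      · omega
      · obtain ⟨k, rfl⟩ : ∃ k, i = k + 1 := ⟨i - 1, by omega⟩
        have h1 := hn k (by omega) hip
        rw [ht_mul k (by omega) hip] at h1
        exact Nat.pos_of_mul_pos_right (show 0 < t (k + 1) * d (k + 1) by omega)
    · induction i, hi using Nat.le_induction with
      | base => intro _; simp [ht_one, hd_one]
      | succ i hi ih =>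
        intro hip
        rw [Finset.sum_Icc_succ_top (by omega), ← ih (by omega), ht_mul i hi hip]
    · obtain ⟨q, hq⟩ := hd_dvd i
      obtain ⟨r, hr⟩ := hd_n i hi
      have hpos := hd_pos (i + 1) (by omega) hip
      have hg := hd_succ i
      rw [ht_mul i hi hip, hr, Nat.gcd_mul_left_add_right, hq, mul_comm (t (i + 1)),
        Nat.gcd_mul_left] at hg
      rw [hq, Nat.mul_div_cancel_left q hpos]
      exact Nat.eq_of_mul_eq_mul_left hpos (by rw [← hg, mul_one])
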